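/- Let X be a compact metric space, f : X → X continuous, C a chain component of f and g = f|_C. Then for any x, y ∈ C, x ∼_C y if and only if (x, y) is a chain proximal pair for g, i.e., for every δ > 0 there is a pair of δ-chains ((x_i)_{i=0}^k, (y_i)_{i=0}^k) of g with (x_0, y_0) = (x, y) and x_k = y_k. -/

import Mathlib

open Filter Metric Set Topology

section Defs

variable {X : Type*} [MetricSpace X]

/-- A δ-chain of `f` of length `k` (with `k ≥ 1`) within the set `C`, from `x` to `y`. -/
def ChainIn (f : X → X) (C : Set X) (δ : ℝ) (k : ℕ) (x y : X) : Prop :=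
  1 ≤ k ∧ ∃ c : ℕ → X, c 0 = x ∧ c k = y ∧ (∀ i ≤ k, c i ∈ C) ∧
    ∀ i < k, dist (f (c i)) (c (i + 1)) ≤ δ

/-- `x → y` : for every `δ > 0` there is a `δ`-chain of `f` from `x` to `y`. -/
def ChainReach (f : X → X) (x y : X) : Prop :=
  ∀ δ > 0, ∃ k, ChainIn f Set.univ δ k x y

/-- `x` is chain recurrent for `f`. -/
def ChainRecurrent (f : X → X) (x : X) : Prop := ChainReach f x x

/-- `C` is a chain component of `f`: an equivalence class of the relation `↔`
on the set of chain recurrent points. -/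
def IsChainComponent (f : X → X) (C : Set X) : Prop :=
  ∃ x, ChainRecurrent f x ∧
    C = {y | ChainRecurrent f y ∧ ChainReach f x y ∧ ChainReach f y x}

/-- The set of lengths of δ-cycles of `f` restricted to `C`. -/
def cycleLengths (f : X → X) (C : Set X) (δ : ℝ) : Set ℕ :=
  {k | ∃ x ∈ C, ChainIn f C δ k x x}

/-- The greatest common divisor of a set of natural numbers
(the greatest natural number dividing every element). -/
noncomputable def setGcd (S : Set ℕ) : ℕ := sSup {d | ∀ k ∈ S, d ∣ k}

/-- `x ∼_{C,δ} y` : there is a δ-chain of `f|_C` from `x` to `y` whose length is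
divisible by `m(C,δ)`, the gcd of the lengths of all δ-cycles of `f|_C`. -/
def SimCd (f : X → X) (C : Set X) (δ : ℝ) (x y : X) : Prop :=
  ∃ k, setGcd (cycleLengths f C δ) ∣ k ∧ ChainIn f C δ k x y

/-- `x ∼_C y` : `x ∼_{C,δ} y` for all `δ > 0`. -/
def SimC (f : X → X) (C : Set X) (x y : X) : Prop :=
  ∀ δ > 0, SimCd f C δ x y

/-- `𝒟(C,δ)` : the set of equivalence classes of `∼_{C,δ}`. -/
def DClassesd (f : X → X) (C : Set X) (δ : ℝ) : Set (Set X) :=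
  {D | ∃ x ∈ C, D = {y ∈ C | SimCd f C δ x y}}

/-- `𝒟(C)` : the set of equivalence classes of `∼_C`. -/
def DClasses (f : X → X) (C : Set X) : Set (Set X) :=
  {D | ∃ x ∈ C, D = {y ∈ C | SimC f C x y}}

/-- `W^s(C) = {x : lim_{i→∞} d(f^i(x), C) = 0}`. -/
def wStable (f : X → X) (C : Set X) : Set X :=
  {x | Tendsto (fun i => infDist (f^[i] x) C) atTop (nhds 0)}

/-- `V^s(D) = ⋂_{δ>0} {x ∈ W^s(C) : lim_{i→∞} d(f^i(x), f^i(D_δ)) = 0}`, where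
`D_δ` is the unique element of `𝒟(C,δ)` containing `D`. -/
def vStable (f : X → X) (C D : Set X) : Set X :=
  {x | x ∈ wStable f C ∧ ∀ δ > 0, ∀ Dd ∈ DClassesd f C δ, D ⊆ Dd →
    Tendsto (fun i => infDist (f^[i] x) (f^[i] '' Dd)) atTop (nhds 0)}

/-- The s-limit shadowing property. -/
def SLimitShadowing (f : X → X) : Prop :=
  ∀ ε > 0, ∃ δ > 0, ∀ x : ℕ → X,
    (∀ i, dist (f (x i)) (x (i + 1)) ≤ δ) →
    Tendsto (fun i => dist (f (x i)) (x (i + 1))) atTop (nhds 0) →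
    ∃ z : X, (∀ i, dist (f^[i] z) (x i) ≤ ε) ∧
      Tendsto (fun i => dist (f^[i] z) (x i)) atTop (nhds 0)

/-- The limit shadowing property. -/
def LimitShadowing (f : X → X) : Prop :=
  ∀ x : ℕ → X, Tendsto (fun i => dist (f (x i)) (x (i + 1))) atTop (nhds 0) →
    ∃ z : X, Tendsto (fun i => dist (f^[i] z) (x i)) atTop (nhds 0)

/-- The (plain) shadowing property. -/
def ShadowingProperty (f : X → X) : Prop :=
  ∀ ε > 0, ∃ δ > 0, ∀ x : ℕ → X, (∀ i, dist (f (x i)) (x (i + 1)) ≤ δ) →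
    ∃ z : X, ∀ i, dist (f^[i] z) (x i) ≤ ε

/-- A Furstenberg family: hereditary upward and proper. -/
def FurstenbergFamily (F : Set (Set ℕ)) : Prop :=
  (∀ A B : Set ℕ, A ∈ F → A ⊆ B → B ∈ F) ∧ F.Nonempty ∧ F ≠ Set.univ

/-- A full Furstenberg family. -/
def FullFamily (F : Set (Set ℕ)) : Prop :=
  ∀ A ∈ F, ∀ n : ℕ, {i ∈ A | n ≤ i} ∈ F

/-- A translation invariant Furstenberg family. -/
def TranslationInvariantFamily (F : Set (Set ℕ)) : Prop :=
  ∀ A ∈ F, ∀ n : ℕ, ((fun i => i + n) '' A ∈ F ∧ {i | i + n ∈ A} ∈ F)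

/-- `S_f(x₁,…,xₙ; r) = {i : min_{j<k} d(fⁱ(x_j), fⁱ(x_k)) > r}`. -/
def Sset (f : X → X) {n : ℕ} (x : Fin n → X) (r : ℝ) : Set ℕ :=
  {i | ∀ j k : Fin n, j < k → r < dist (f^[i] (x j)) (f^[i] (x k))}

/-- `T_f(x₁,…,xₙ; r) = {i : max_{j<k} d(fⁱ(x_j), fⁱ(x_k)) < r}`. -/
def Tset (f : X → X) {n : ℕ} (x : Fin n → X) (r : ℝ) : Set ℕ :=
  {i | ∀ j k : Fin n, j < k → dist (f^[i] (x j)) (f^[i] (x k)) < r}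

/-- `(x₁,…,xₙ)` is an `(ℱ,𝒢)`-δ-scrambled n-tuple for `f`. -/
def Scrambled (f : X → X) (F G : Set (Set ℕ)) (δ : ℝ) {n : ℕ} (x : Fin n → X) : Prop :=
  Sset f x δ ∈ F ∧ ∀ ε > 0, Tset f x ε ∈ G

/-- `Y` is dense `(ℱ,𝒢)`-n-δ-chaotic for `f`: the `(ℱ,𝒢)`-δ-scrambled n-tuples in `Yⁿ`
form a dense subset of `Yⁿ`. -/
def DenseChaotic (f : X → X) (F G : Set (Set ℕ)) (n : ℕ) (δ : ℝ) (Y : Set X) : Prop :=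
  {x : Fin n → X | ∀ j, x j ∈ Y} ⊆
    closure {x : Fin n → X | (∀ j, x j ∈ Y) ∧ Scrambled f F G δ x}

/-- `S` is a residual subset of the subspace `T`: it contains a countable intersection of
dense open subsets of `T`. -/
def ResidualIn {α : Type*} [TopologicalSpace α] (T S : Set α) : Prop :=
  ∃ U : ℕ → Set α, (∀ i, IsOpen (U i)) ∧ (∀ i, T ⊆ closure (U i ∩ T)) ∧
    (⋂ i, U i) ∩ T ⊆ S

/-- `Y` is generic `(ℱ,𝒢)`-n-δ-chaotic for `f`: the `(ℱ,𝒢)`-δ-scrambled n-tuples in `Yⁿ`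
form a residual subset of `Yⁿ`. -/
def GenericChaotic (f : X → X) (F G : Set (Set ℕ)) (n : ℕ) (δ : ℝ) (Y : Set X) : Prop :=
  ResidualIn {x : Fin n → X | ∀ j, x j ∈ Y}
    {x : Fin n → X | (∀ j, x j ∈ Y) ∧ Scrambled f F G δ x}

/-- A Furstenberg family `F` is compatible with `(Z, g)`. -/
def CompatibleFamily {Z : Type*} [TopologicalSpace Z] (F : Set (Set ℕ)) (g : Z → Z) : Prop :=
  ∀ U : Set Z, IsOpen U → IsGδ {z | {i | g^[i] z ∈ U} ∈ F}

end Defs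

section Chains

variable {X : Type*} [MetricSpace X] {f : X → X} {C : Set X} {δ : ℝ} {k l : ℕ} {x y z : X}

theorem ChainIn.right_mem (h : ChainIn f C δ k x y) : y ∈ C := by
  obtain ⟨-, c, -, rfl, hC, -⟩ := h
  exact hC k le_rfl

theorem ChainIn.trans (h₁ : ChainIn f C δ k x y) (h₂ : ChainIn f C δ l y z) :
    ChainIn f C δ (k + l) x z := by
  obtain ⟨hk, c, hc0, hck, hcC, hc⟩ := h₁
  obtain ⟨hl, d, hd0, hdl, hdC, hd⟩ := h₂
  refine ⟨by omega, fun i => if i ≤ k then c i else d (i - k), by simp [hc0], ?_, ?_, ?_⟩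
  · simp [hdl, show ¬ k + l ≤ k by omega]
  · intro i hi
    dsimp only
    split_ifs with h
    · exact hcC i h
    · exact hdC _ (by omega)
  · intro i hi
    dsimp only
    rcases lt_trichotomy i k with h | rfl | h
    · rw [if_pos h.le, if_pos (by omega)]
      exact hc i h
    · rw [if_pos le_rfl, if_neg (by omega), hck, ← hd0, show i + 1 - i = 0 + 1 by omega]
      exact hd 0 hl
    · rw [if_neg (by omega), if_neg (by omega), show i + 1 - k = i - k + 1 by omega]
      exact hd _ (by omega)

theorem ChainReach.trans (h₁ : ChainReach f x y) (h₂ : ChainReach f y z) : ChainReach f x z := by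
  intro δ hδ
  obtain ⟨k, hk⟩ := h₁ δ hδ
  obtain ⟨l, hl⟩ := h₂ δ hδ
  exact ⟨k + l, hk.trans hl⟩

theorem ChainIn.changeRight {ε r : ℝ} (h : ChainIn f C ε k x y) (hz : z ∈ C)
    (hr : dist y z ≤ r) (hδ : ε + r ≤ δ) : ChainIn f C δ k x z := by
  have hr0 : 0 ≤ r := dist_nonneg.trans hr
  obtain ⟨hk, c, hc0, hck, hcC, hc⟩ := h
  refine ⟨hk, Function.update c k z, ?_, by simp, ?_, ?_⟩
  · rw [Function.update_of_ne (by omega), hc0]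
  · intro i hi
    by_cases h : i = k
    · simpa [h] using hz
    · rw [Function.update_of_ne h]
      exact hcC i hi
  · intro i hi
    rw [Function.update_of_ne hi.ne]
    by_cases h : i + 1 = k
    · have := hc i hi
      rw [h, hck] at this
      rw [h, Function.update_self]
      linarith [dist_triangle (f (c i)) y z]
    · rw [Function.update_of_ne h]
      linarith [hc i hi]

theorem ChainIn.changeLeft {ε r : ℝ} (h : ChainIn f C ε k x y) (hz : z ∈ C)
    (hr : dist (f z) (f x) ≤ r) (hδ : ε + r ≤ δ) : ChainIn f C δ k z y := by
  have hr0 : 0 ≤ r := dist_nonneg.trans hr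
  obtain ⟨hk, c, hc0, hck, hcC, hc⟩ := h
  refine ⟨hk, Function.update c 0 z, by simp, ?_, ?_, ?_⟩
  · rw [Function.update_of_ne (by omega), hck]
  · intro i hi
    by_cases h : i = 0
    · simpa [h] using hz
    · rw [Function.update_of_ne h]
      exact hcC i hi
  · intro i hi
    rw [Function.update_of_ne i.succ_ne_zero]
    by_cases h : i = 0
    · subst h
      have := hc 0 hi
      rw [hc0] at this
      rw [Function.update_self]
      linarith [dist_triangle (f z) (f x) (c (0 + 1))]
    · rw [Function.update_of_ne h]
      linarith [hc i hi]

theorem ChainIn.split {c : ℕ → X} (hcC : ∀ i ≤ k, c i ∈ C)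
    (hc : ∀ i < k, dist (f (c i)) (c (i + 1)) ≤ δ) {i : ℕ} (h0 : 0 < i) (hi : i < k) :
    ChainIn f C δ i (c 0) (c i) ∧ ChainIn f C δ (k - i) (c i) (c k) := by
  refine ⟨⟨h0, c, rfl, rfl, fun j hj => hcC j (by omega), fun j hj => hc j (by omega)⟩,
    by omega, fun j => c (i + j), rfl, ?_, fun j hj => hcC _ (by omega),
    fun j hj => hc _ (by omega)⟩
  simp only [Nat.add_sub_cancel' hi.le]

theorem IsChainComponent.reach (hC : IsChainComponent f C) (hx : x ∈ C) (hy : y ∈ C) :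
    ChainReach f x y := by
  obtain ⟨p, -, rfl⟩ := hC
  exact hx.2.2.trans hy.2.1

theorem IsChainComponent.mem_of_reach (hC : IsChainComponent f C) (hx : x ∈ C) (hy : y ∈ C)
    (hxz : ChainReach f x z) (hzy : ChainReach f z y) : z ∈ C := by
  have hyx := hC.reach hy hx
  obtain ⟨p, -, rfl⟩ := hC
  exact ⟨(hzy.trans hyx).trans hxz, hx.2.1.trans hxz, hzy.trans hy.2.2⟩

/-- A limit of points lying on ever finer chains from `x` to `y` belongs to the component. -/
theorem IsChainComponent.mem_of_tendsto (hC : IsChainComponent f C) (hf : Continuous f)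
    (hx : x ∈ C) (hy : y ∈ C) {u : ℕ → X} {ε : ℕ → ℝ} (hu : Tendsto u atTop (𝓝 z))
    (hε : Tendsto ε atTop (𝓝 0))
    (hxu : ∀ n, ∃ k, ChainIn f Set.univ (ε n) k x (u n))
    (huy : ∀ n, ∃ k, ChainIn f Set.univ (ε n) k (u n) y) : z ∈ C := by
  have hfu : Tendsto (fun n => f (u n)) atTop (𝓝 (f z)) := (hf.tendsto z).comp hu
  refine hC.mem_of_reach hx hy (fun δ hδ => ?_) (fun δ hδ => ?_)
  · obtain ⟨n, hn, hεn⟩ := ((Metric.tendsto_nhds.1 hu (δ / 2) (half_pos hδ)).and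
      (hε.eventually (gt_mem_nhds (half_pos hδ)))).exists
    obtain ⟨k, hk⟩ := hxu n
    exact ⟨k, hk.changeRight (mem_univ z) hn.le (by linarith)⟩
  · obtain ⟨n, hn, hεn⟩ := ((Metric.tendsto_nhds.1 hfu (δ / 2) (half_pos hδ)).and
      (hε.eventually (gt_mem_nhds (half_pos hδ)))).exists
    obtain ⟨k, hk⟩ := huy n
    exact ⟨k, hk.changeLeft (mem_univ z) ((dist_comm _ _).trans_le hn.le) (by linarith)⟩

/-- Sufficiently fine chains between two points of a chain component stay close to it. -/
theorem IsChainComponent.exists_near [CompactSpace X] (hC : IsChainComponent f C)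
    (hf : Continuous f) (hx : x ∈ C) (hy : y ∈ C) {η : ℝ} (hη : 0 < η) (hδ : 0 < δ) :
    ∃ ε > 0, ε ≤ δ ∧ ∀ u, (∃ k, ChainIn f Set.univ ε k x u) →
      (∃ k, ChainIn f Set.univ ε k u y) → ∃ v ∈ C, dist u v < η := by
  by_contra! H
  have hpos (n : ℕ) : 0 < δ / (n + 1) := by positivity
  have hle (n : ℕ) : δ / (n + 1) ≤ δ :=
    div_le_self hδ.le (by linarith [Nat.cast_nonneg (α := ℝ) n])
  choose u hxu huy hfar using fun n : ℕ => H (δ / (n + 1)) (hpos n) (hle n)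
  obtain ⟨z, φ, hφ, hz⟩ := CompactSpace.tendsto_subseq u
  have hlim : Tendsto (fun n : ℕ => δ / ((n : ℝ) + 1)) atTop (𝓝 0) :=
    tendsto_const_nhds.div_atTop
      (tendsto_atTop_add_const_right _ _ tendsto_natCast_atTop_atTop)
  have hzC : z ∈ C := hC.mem_of_tendsto hf hx hy hz (hlim.comp hφ.tendsto_atTop)
    (fun n => hxu (φ n)) (fun n => huy (φ n))
  obtain ⟨n, hn⟩ := (Metric.tendsto_nhds.1 hz η hη).exists
  exact absurd (hfar (φ n) z hzC) (not_le.2 hn)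

/-- The restriction of `f` to a chain component is chain transitive. -/
theorem IsChainComponent.exists_chainIn [CompactSpace X] (hC : IsChainComponent f C)
    (hf : Continuous f) (hx : x ∈ C) (hy : y ∈ C) (hδ : 0 < δ) : ∃ k, ChainIn f C δ k x y := by
  obtain ⟨η, hη, hfη⟩ := Metric.uniformContinuous_iff.1
    (CompactSpace.uniformContinuous_of_continuous hf) (δ / 3) (by positivity)
  obtain ⟨ε, hε, hεδ, hnear⟩ := hC.exists_near hf hx hy
    (lt_min hη (show 0 < δ / 3 by positivity)) (show 0 < δ / 3 by positivity)
  obtain ⟨k, hk, c, rfl, rfl, hcC, hc⟩ := hC.reach hx hy ε hε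
  have hproj (i : ℕ) (hi : i ≤ k) : ∃ v ∈ C, dist (c i) v < min η (δ / 3) ∧
      (i = 0 ∨ i = k → v = c i) := by
    by_cases h : i = 0 ∨ i = k
    · refine ⟨c i, by rcases h with rfl | rfl <;> assumption, ?_, fun _ => rfl⟩
      rw [dist_self]
      positivity
    · obtain ⟨h₁, h₂⟩ := ChainIn.split hcC hc (i := i) (by omega) (by omega)
      obtain ⟨v, hv, hd⟩ := hnear (c i) ⟨_, h₁⟩ ⟨_, h₂⟩
      exact ⟨v, hv, hd, fun h' => absurd h' h⟩
  have : Nonempty X := ⟨c 0⟩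
  choose! v hvC hvd hve using hproj
  refine ⟨k, hk, v, hve 0 (by omega) (.inl rfl), hve k le_rfl (.inr rfl), hvC, fun i hi => ?_⟩
  have h₁ := hfη ((hvd i hi.le).trans_le (min_le_left _ _))
  have h₂ := (hvd (i + 1) hi).trans_le (min_le_right _ _)
  have h₃ := hc i hi
  rw [dist_comm] at h₁
  linarith [dist_triangle (f (v i)) (f (c i)) (v (i + 1)),
    dist_triangle (f (c i)) (c (i + 1)) (v (i + 1))]

theorem setGcd_eq_natSetGcd {S : Set ℕ} {n : ℕ} (hn : n ∈ S) (hn0 : 0 < n) :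
    setGcd S = Nat.setGcd S := by
  have hpos : 0 < Nat.setGcd S := Nat.pos_of_dvd_of_pos (Nat.setGcd_dvd_of_mem hn) hn0
  refine le_antisymm (csSup_le ⟨1, fun k _ => one_dvd k⟩ fun d hd => ?_)
    (le_csSup ⟨n, fun d hd => Nat.le_of_dvd hn0 (hd n hn)⟩
      fun k hk => Nat.setGcd_dvd_of_mem hk)
  exact Nat.le_of_dvd hpos (Nat.dvd_setGcd_iff.2 hd)

/-- Through every point of a chain component there are cycles of all sufficiently large lengths
divisible by `m(C,δ)`. -/
theorem IsChainComponent.exists_forall_cycle [CompactSpace X] (hC : IsChainComponent f C)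
    (hf : Continuous f) (hy : y ∈ C) (hδ : 0 < δ) :
    ∃ N, ∀ n ≥ N, 1 ≤ n → setGcd (cycleLengths f C δ) ∣ n → ChainIn f C δ n y y := by
  set S : Set ℕ := {n | ChainIn f C δ n y y}
  have hdvd : Nat.setGcd S ∣ setGcd (cycleLengths f C δ) := by
    obtain ⟨k, hk⟩ := hC.exists_chainIn hf hy hy hδ
    rw [setGcd_eq_natSetGcd (S := cycleLengths f C δ) ⟨y, hy, hk⟩ hk.1, Nat.dvd_setGcd_iff]
    rintro l ⟨z, hz, hl⟩
    obtain ⟨a, ha⟩ := hC.exists_chainIn hf hy hz hδ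
    obtain ⟨b, hb⟩ := hC.exists_chainIn hf hz hy hδ
    have h₁ : Nat.setGcd S ∣ a + b := Nat.setGcd_dvd_of_mem (ha.trans hb)
    have h₂ : Nat.setGcd S ∣ a + l + b := Nat.setGcd_dvd_of_mem ((ha.trans hl).trans hb)
    rw [show a + l + b = a + b + l by ring] at h₂
    exact (Nat.dvd_add_right h₁).1 h₂
  obtain ⟨N, hN⟩ := Nat.exists_mem_closure_of_ge S
  refine ⟨N, fun n hn hn1 hd => ?_⟩
  have key : ∀ n ∈ AddSubmonoid.closure S, n = 0 ∨ ChainIn f C δ n y y := by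
    intro n hn
    induction hn using AddSubmonoid.closure_induction with
    | mem n hn => exact .inr hn
    | zero => exact .inl rfl
    | add a b _ _ ha hb =>
      rcases ha with rfl | ha
      · simpa using hb
      · rcases hb with rfl | hb
        · exact .inr ha
        · exact .inr (ha.trans hb)
  exact (key n (hN n hn (hdvd.trans hd))).resolve_left (by omega)

end Chains

/-- Remark 2.3: `x ∼_C y` iff `(x, y)` is a chain proximal pair for
`g = f|_C`, i.e., for every `δ > 0` there is a pair of δ-chains of `g` of the same length,
starting at `x` resp. `y` and ending at the same point. -/
theorem simC_iff_chainProximal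
    {X : Type*} [MetricSpace X] [CompactSpace X] (f : X → X) (hf : Continuous f)
    (C : Set X) (hC : IsChainComponent f C) :
    ∀ x ∈ C, ∀ y ∈ C,
      (SimC f C x y ↔ ∀ δ > 0, ∃ (k : ℕ) (w : X),
        ChainIn f C δ k x w ∧ ChainIn f C δ k y w) := by
  intro x hx y hy
  refine forall₂_congr fun δ hδ => ⟨?_, ?_⟩
  · rintro ⟨k, hdvd, hk⟩
    obtain ⟨N, hN⟩ := hC.exists_forall_cycle hf hy hδ
    have hk1 := hk.1
    have hNk : N ≤ N * k := Nat.le_mul_of_pos_right N hk1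
    have hlong := hN (k + (N + 1) * k) (by linarith) (by omega)
      (dvd_add hdvd (hdvd.mul_left _))
    have hcyc := hN ((N + 1) * k) (by linarith) (by linarith) (hdvd.mul_left _)
    exact ⟨_, y, hk.trans hcyc, hlong⟩
  · rintro ⟨k, w, hxw, hyw⟩
    obtain ⟨l, hl⟩ := hC.exists_chainIn hf hxw.right_mem hy hδ
    have hcyc := hyw.trans hl
    have hmem : k + l ∈ cycleLengths f C δ := ⟨y, hy, hcyc⟩
    refine ⟨k + l, ?_, hxw.trans hl⟩
    rw [setGcd_eq_natSetGcd hmem hcyc.1]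
    exact Nat.setGcd_dvd_of_mem hmem
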